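/- Let p be a prime and let G be a finite group of order p^n such that every two non-trivial cyclic subgroups of G have the same Chermak–Delgado measure. Then for every non-trivial cyclic subgroup H of G, the common value of the Chermak–Delgado measure is m_G(H) = p^(n+1) = p · |G|. -/

import Mathlib

/-- The Chermak–Delgado measure of a subgroup `H` of `G`:
`m_G(H) = |H| * |C_G(H)|`. -/
noncomputable def cdMeasure (G : Type*) [Group G] (H : Subgroup G) : ℕ :=
  Nat.card H * Nat.card (Subgroup.centralizer (H : Set G))

theorem cdMeasure_zpowers_of_mem_center {G : Type*} [Group G] {z : G}
    (hz : z ∈ Subgroup.center G) :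
    cdMeasure G (Subgroup.zpowers z) = orderOf z * Nat.card G := by
  have hle : (Subgroup.zpowers z : Set G) ⊆ Subgroup.center G :=
    Subgroup.zpowers_le.mpr hz
  rw [cdMeasure, Nat.card_zpowers, Subgroup.centralizer_eq_top_iff_subset.mpr hle,
    Subgroup.card_top]

theorem IsPGroup.exists_mem_center_orderOf_eq {p : ℕ} [Fact p.Prime] {G : Type*} [Group G]
    [Finite G] [Nontrivial G] (hG : IsPGroup p G) :
    ∃ z ∈ Subgroup.center G, orderOf z = p := by
  have : Nontrivial (Subgroup.center G) := hG.center_nontrivial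
  obtain ⟨k, hk, hcard⟩ := (hG.to_subgroup (Subgroup.center G)).nontrivial_iff_card.mp this
  obtain ⟨z, hz⟩ := exists_prime_orderOf_dvd_card' (G := Subgroup.center G) p
    (hcard ▸ dvd_pow_self p hk.ne')
  exact ⟨z, z.2, by rw [Subgroup.orderOf_coe, hz]⟩

/-- If |G| = p^n and all non-trivial cyclic subgroups of G have the same
Chermak–Delgado measure, then this common value is p^(n+1) = p * |G|. -/
theorem stmt_3 (p : ℕ) (hp : p.Prime) (n : ℕ) (G : Type*) [Group G] [Finite G]
    (hcard : Nat.card G = p ^ n)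
    (h : ∀ H₁ H₂ : Subgroup G, H₁ ≠ ⊥ → H₂ ≠ ⊥ → IsCyclic H₁ → IsCyclic H₂ →
      cdMeasure G H₁ = cdMeasure G H₂) :
    ∀ H : Subgroup G, H ≠ ⊥ → IsCyclic H →
      cdMeasure G H = p ^ (n + 1) ∧ cdMeasure G H = p * Nat.card G := by
  intro H hH hcyc
  have : Fact p.Prime := ⟨hp⟩
  have : Nontrivial G :=
    have : Nontrivial H := (Subgroup.nontrivial_iff_ne_bot H).mpr hH
    H.subtype_injective.nontrivial
  obtain ⟨z, hz, hzp⟩ := (IsPGroup.of_card hcard).exists_mem_center_orderOf_eq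
  have hz_ne : Subgroup.zpowers z ≠ ⊥ := by
    rw [Ne, Subgroup.zpowers_eq_bot, ← orderOf_eq_one_iff, hzp]
    exact hp.ne_one
  have hm : cdMeasure G H = p * Nat.card G := by
    rw [h H _ hH hz_ne hcyc inferInstance, cdMeasure_zpowers_of_mem_center hz, hzp]
  exact ⟨by rw [hm, hcard, pow_succ'], hm⟩
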